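/- Let λ ∈ K^{(𝒯)} be nonzero and let t0 ∈ 𝒯 be such that λ_{t0} ≠ 0. Then the prelie algebra (g_{D,𝒯}, •_λ) is freely generated by the set T^{(t0)}_{D,𝒯}: for any prelie algebra (A, ◁) and any map f : T^{(t0)}_{D,𝒯} → A, there exists a unique linear map φ : g_{D,𝒯} → A such that φ(x •_λ y) = φ(x) ◁ φ(y) for all x, y ∈ g_{D,𝒯} and φ(S) = f(S) for all S ∈ T^{(t0)}_{D,𝒯}. -/

import Mathlib

open scoped TensorProduct

/-- Underlying data of a `D`-decorated `T`-typed rooted tree: a root decoration together with a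
list of pairs (edge type, subtree). -/
inductive PreTree (D T : Type) : Type
  | node : D → List (T × PreTree D T) → PreTree D T

namespace PreTree
variable {D T : Type}

/-- One-step rearrangement of children; it generates the identification of trees whose children
form the same multiset of (type, subtree) pairs. -/
inductive Swap : PreTree D T → PreTree D T → Prop
  | swap (d : D) (l₁ l₂ : List (T × PreTree D T)) (p q : T × PreTree D T) :
      Swap (.node d (l₁ ++ p :: q :: l₂)) (.node d (l₁ ++ q :: p :: l₂))
  | congr (d : D) (l₁ l₂ : List (T × PreTree D T)) (t : T) (s s' : PreTree D T) :
      Swap s s' → Swap (.node d (l₁ ++ (t, s) :: l₂)) (.node d (l₁ ++ (t, s') :: l₂))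

end PreTree

instance preTreeSetoid (D T : Type) : Setoid (PreTree D T) :=
  ⟨Relation.EqvGen PreTree.Swap, Relation.EqvGen.is_equivalence _⟩

/-- `D`-decorated `T`-typed rooted trees: the root is decorated by an element of `D` and carries
a finite multiset of pairs (type, subtree). -/
abbrev TypedTree (D T : Type) : Type := Quotient (preTreeSetoid D T)
namespace PreTree
variable {D T : Type}

mutual
/-- The list of all graftings `S •_t^{(v)} S'` of `S'` on a vertex `v` of `S`, the new edge
having type `t` (one entry for each vertex `v` of `S`). -/
def graftAll (t : T) (s' : PreTree D T) : PreTree D T → List (PreTree D T)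
  | .node d l => .node d ((t, s') :: l) :: (graftAllL t s' l).map (fun l' => .node d l')
def graftAllL (t : T) (s' : PreTree D T) :
    List (T × PreTree D T) → List (List (T × PreTree D T))
  | [] => []
  | (u, c) :: rest =>
      ((graftAll t s' c).map fun c' => (u, c') :: rest) ++
      ((graftAllL t s' rest).map fun r => (u, c) :: r)
end

end PreTree

variable (K : Type) [Field K]

/-- `g_{D,T}`: the free `K`-vector space with basis the set of `D`-decorated `T`-typed
rooted trees. -/
abbrev gDT (K D T : Type) [Field K] : Type := TypedTree D T →₀ K

/-- The grafting product `•_t`, defined on basis trees by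
`S •_t S' = Σ_{v ∈ V(S)} S •_t^{(v)} S'`, extended bilinearly. -/
noncomputable def bulletL {D T : Type} (t : T) :
    gDT K D T →ₗ[K] gDT K D T →ₗ[K] gDT K D T :=
  Finsupp.lift (gDT K D T →ₗ[K] gDT K D T) K (TypedTree D T) fun a =>
    Finsupp.lift (gDT K D T) K (TypedTree D T) fun b =>
      ((PreTree.graftAll t b.out a.out).map
        fun r => Finsupp.single (⟦r⟧ : TypedTree D T) (1 : K)).sum
/-- For `λ ∈ K^{(𝒯)}` (finitely supported family of scalars), the product
`•_λ = Σ_t λ_t •_t`. -/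
noncomputable def bulletLam {D T : Type} (lam : T →₀ K) :
    gDT K D T →ₗ[K] gDT K D T →ₗ[K] gDT K D T :=
  lam.sum fun t c => c • bulletL K t
namespace PreTree
/-- The types of the edges outgoing the root. -/
def rootTypes {D T : Type} : PreTree D T → List T
  | .node _ l => l.map Prod.fst
end PreTree

/-- The set `T^{(t0)}_{D,𝒯}` of trees having no edge of type `t0` incident to the root. -/
def NoRootEdge {D T : Type} (t0 : T) (x : TypedTree D T) : Prop :=
  ∃ p : PreTree D T, ⟦p⟧ = x ∧ t0 ∉ p.rootTypes

namespace PreTree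
variable {D T : Type}

mutual
/-- The number of vertices of a tree. -/
def vertexCount : PreTree D T → ℕ
  | .node _ l => 1 + vertexCountL l
/-- The total number of vertices of the subtrees in a list of children. -/
def vertexCountL : List (T × PreTree D T) → ℕ
  | [] => 0
  | (_, c) :: rest => vertexCount c + vertexCountL rest
end

theorem vertexCountL_eq_sum (l : List (T × PreTree D T)) :
    vertexCountL l = (l.map fun p => vertexCount p.2).sum := by
  induction l with
  | nil => simp [vertexCountL]
  | cons p l ih => obtain ⟨t, c⟩ := p; simp [vertexCountL, ih]

mutual
theorem vertexCount_of_mem_graftAll (t : T) (b : PreTree D T) :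
    ∀ a, ∀ r ∈ graftAll t b a, vertexCount r = vertexCount a + vertexCount b
  | .node d l, r, hr => by
    simp only [graftAll, List.mem_cons, List.mem_map] at hr
    rcases hr with rfl | ⟨l', hl', rfl⟩
    · simp only [vertexCount, vertexCountL]; ring
    · simp only [vertexCount, vertexCountL_of_mem_graftAllL t b l l' hl']; ring
theorem vertexCountL_of_mem_graftAllL (t : T) (b : PreTree D T) :
    ∀ l, ∀ r ∈ graftAllL t b l, vertexCountL r = vertexCountL l + vertexCount b
  | [], r, hr => by simp [graftAllL] at hr
  | (u, c) :: rest, r, hr => by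
    simp only [graftAllL, List.mem_append, List.mem_map] at hr
    rcases hr with ⟨c', hc', rfl⟩ | ⟨r', hr', rfl⟩
    · simp only [vertexCountL, vertexCount_of_mem_graftAll t b c c' hc']; ring
    · simp only [vertexCountL, vertexCountL_of_mem_graftAllL t b rest r' hr']; ring
end

/-- A function on trees that is invariant under elementary rearrangements of children is
invariant under the identification of trees. -/
theorem eq_of_equiv {α : Type*} (g : PreTree D T → α) (hg : ∀ a b, Swap a b → g a = g b)
    {a b : PreTree D T} (hab : a ≈ b) : g a = g b := by
  have hab' : Relation.EqvGen Swap a b := hab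
  induction hab' with
  | rel _ _ h => exact hg _ _ h
  | refl _ => rfl
  | symm _ _ h ih => exact (ih h).symm
  | trans _ _ _ h₁ h₂ ih₁ ih₂ => exact (ih₁ h₁).trans (ih₂ h₂)

theorem Swap.mk_eq {a b : PreTree D T} (h : Swap a b) : (⟦a⟧ : TypedTree D T) = ⟦b⟧ :=
  Quotient.sound (Relation.EqvGen.rel _ _ h)

theorem Swap.vertexCount_eq {a b : PreTree D T} (h : Swap a b) :
    vertexCount a = vertexCount b := by
  induction h with
  | swap d l₁ l₂ p q => simp [vertexCount, vertexCountL_eq_sum]; ring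
  | congr d l₁ l₂ t s s' _ ih => simp [vertexCount, vertexCountL_eq_sum, ih]

/-- The multiset of (type, tree) pairs underlying a list of children. -/
def childMultiset (l : List (T × PreTree D T)) : Multiset (T × TypedTree D T) :=
  ↑(l.map fun p => (p.1, (⟦p.2⟧ : TypedTree D T)))

@[simp] theorem childMultiset_nil : childMultiset ([] : List (T × PreTree D T)) = 0 := rfl

@[simp] theorem childMultiset_cons (p : T × PreTree D T) (l : List (T × PreTree D T)) :
    childMultiset (p :: l) = (p.1, (⟦p.2⟧ : TypedTree D T)) ::ₘ childMultiset l := rfl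

@[simp] theorem childMultiset_append (l₁ l₂ : List (T × PreTree D T)) :
    childMultiset (l₁ ++ l₂) = childMultiset l₁ + childMultiset l₂ := by
  simp [childMultiset]

/-- The decoration of the root. -/
def rootDec : PreTree D T → D
  | .node d _ => d

/-- The multiset of pairs (edge type, subtree) at the root. -/
def children : PreTree D T → Multiset (T × TypedTree D T)
  | .node _ l => childMultiset l

theorem mk_node_congr (d : D) (l₀ : List (T × PreTree D T)) (u : T) {c c' : PreTree D T}
    (l : List (T × PreTree D T)) (h : c ≈ c') :
    (⟦node d (l₀ ++ (u, c) :: l)⟧ : TypedTree D T) = ⟦node d (l₀ ++ (u, c') :: l)⟧ :=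
  eq_of_equiv (fun c => (⟦node d (l₀ ++ (u, c) :: l)⟧ : TypedTree D T))
    (fun _ _ h => (Swap.congr d l₀ l u _ _ h).mk_eq) h

theorem mk_node_append_out (d : D) (l₀ l : List (T × PreTree D T)) :
    (⟦node d (l₀ ++ l.map fun p => (p.1, (⟦p.2⟧ : TypedTree D T).out))⟧ : TypedTree D T) =
      ⟦node d (l₀ ++ l)⟧ := by
  induction l generalizing l₀ with
  | nil => rfl
  | cons p l ih =>
    rw [List.map_cons, mk_node_congr d l₀ p.1 _ (Quotient.mk_out p.2)]
    simpa using ih (l₀ ++ [p])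

theorem mk_node_append_perm (d : D) {l l' : List (T × PreTree D T)} (h : l.Perm l')
    (l₀ : List (T × PreTree D T)) :
    (⟦node d (l₀ ++ l)⟧ : TypedTree D T) = ⟦node d (l₀ ++ l')⟧ := by
  induction h generalizing l₀ with
  | nil => rfl
  | cons p _ ih => simpa using ih (l₀ ++ [p])
  | swap p q l => exact (Swap.swap d l₀ l q p).mk_eq
  | trans _ _ ih₁ ih₂ => exact (ih₁ l₀).trans (ih₂ l₀)

end PreTree

namespace TypedTree
variable {D T : Type}
open PreTree

/-- The tree with given root decoration and multiset of children. -/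
noncomputable def ofChildren (d : D) (m : Multiset (T × TypedTree D T)) : TypedTree D T :=
  Quotient.liftOn m (fun l => ⟦node d (l.map fun p => (p.1, p.2.out))⟧)
    fun _ _ h => mk_node_append_perm d (h.map _) []

@[simp] theorem ofChildren_childMultiset (d : D) (l : List (T × PreTree D T)) :
    ofChildren d (childMultiset l) = ⟦node d l⟧ := by
  have := mk_node_append_out d [] l
  simpa [ofChildren, childMultiset, Function.comp_def] using this

/-- The decoration of the root. -/
def rootDec : TypedTree D T → D :=
  Quotient.lift PreTree.rootDec fun _ _ =>
    eq_of_equiv _ fun _ _ h => by cases h <;> rfl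

/-- The multiset of pairs (edge type, subtree) at the root. -/
def children : TypedTree D T → Multiset (T × TypedTree D T) :=
  Quotient.lift PreTree.children fun _ _ =>
    eq_of_equiv _ fun _ _ h => by
      cases h with
      | swap d l₁ l₂ p q => simp [PreTree.children, Multiset.cons_swap]
      | congr d l₁ l₂ t s s' h => simp [PreTree.children, h.mk_eq]

/-- The number of vertices of a tree. -/
def numVertices : TypedTree D T → ℕ :=
  Quotient.lift vertexCount fun _ _ => eq_of_equiv _ fun _ _ h => h.vertexCount_eq

@[simp] theorem ofChildren_rootDec_children (a : TypedTree D T) :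
    ofChildren (rootDec a) (children a) = a := by
  induction a using Quotient.inductionOn with
  | h a => cases a with
    | node d l => exact ofChildren_childMultiset d l

theorem exists_childMultiset_eq (m : Multiset (T × TypedTree D T)) :
    ∃ l, childMultiset l = m := by
  induction m using Multiset.induction_on with
  | empty => exact ⟨[], rfl⟩
  | cons p m ih =>
    obtain ⟨l, rfl⟩ := ih
    exact ⟨(p.1, p.2.out) :: l, by simp⟩

@[simp] theorem rootDec_ofChildren (d : D) (m : Multiset (T × TypedTree D T)) :
    rootDec (ofChildren d m) = d := by
  obtain ⟨l, rfl⟩ := exists_childMultiset_eq m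
  rw [ofChildren_childMultiset]; rfl

@[simp] theorem children_ofChildren (d : D) (m : Multiset (T × TypedTree D T)) :
    children (ofChildren d m) = m := by
  obtain ⟨l, rfl⟩ := exists_childMultiset_eq m
  rw [ofChildren_childMultiset]; rfl

@[simp] theorem numVertices_ofChildren (d : D) (m : Multiset (T × TypedTree D T)) :
    numVertices (ofChildren d m) = 1 + (m.map fun p => numVertices p.2).sum := by
  obtain ⟨l, rfl⟩ := exists_childMultiset_eq m
  rw [ofChildren_childMultiset]
  change vertexCount (node d l) = _
  simp [vertexCount, vertexCountL_eq_sum, childMultiset, Function.comp_def, numVertices]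

theorem numVertices_pos (a : TypedTree D T) : 0 < numVertices a := by
  rw [← ofChildren_rootDec_children a, numVertices_ofChildren]; omega

/-- Structural induction on trees. -/
theorem induction_children {P : TypedTree D T → Prop}
    (h : ∀ d m, (∀ p ∈ m, P p.2) → P (ofChildren d m)) (a : TypedTree D T) : P a := by
  induction hn : numVertices a using Nat.strong_induction_on generalizing a with
  | h n ih =>
    rw [← ofChildren_rootDec_children a] at hn ⊢
    refine h _ _ fun p hp => ih _ ?_ p.2 rfl
    rw [numVertices_ofChildren] at hn
    have := Multiset.single_le_sum (fun _ _ => Nat.zero_le _) _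
      (Multiset.mem_map_of_mem (fun p : T × TypedTree D T => numVertices p.2) hp)
    omega

theorem noRootEdge_iff (t0 : T) (a : TypedTree D T) :
    NoRootEdge t0 a ↔ ∀ p ∈ children a, p.1 ≠ t0 := by
  constructor
  · rintro ⟨⟨d, l⟩, rfl, h⟩ p hp rfl
    have hp' : p ∈ childMultiset l := hp
    simp only [childMultiset, Multiset.mem_coe, List.mem_map] at hp'
    obtain ⟨q, hq, rfl⟩ := hp'
    exact h (List.mem_map_of_mem hq)
  · induction a using Quotient.inductionOn with
    | h a => cases a with
      | node d l =>
        refine fun h => ⟨node d l, rfl, fun hm => ?_⟩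
        obtain ⟨q, hq, rfl⟩ := List.mem_map.1 hm
        exact h (q.1, ⟦q.2⟧) (List.mem_map.2 ⟨q, hq, rfl⟩) rfl

end TypedTree

namespace TypedTree
section
variable {K D T : Type} [Field K]
open PreTree MvPolynomial

/-- The commutative monomial attached to a multiset of children. -/
noncomputable def forestMonomial (K : Type) [Field K] {D T : Type}
    (m : Multiset (T × TypedTree D T)) : MvPolynomial (T × TypedTree D T) K :=
  (m.map X).prod

@[simp] theorem forestMonomial_zero :
    forestMonomial K (0 : Multiset (T × TypedTree D T)) = 1 := by
  simp [forestMonomial]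

@[simp] theorem forestMonomial_cons (p : T × TypedTree D T) (m : Multiset (T × TypedTree D T)) :
    forestMonomial K (p ::ₘ m) = X p * forestMonomial K m := by
  simp [forestMonomial]

@[simp] theorem forestMonomial_add (m m' : Multiset (T × TypedTree D T)) :
    forestMonomial K (m + m') = forestMonomial K m * forestMonomial K m' := by
  simp [forestMonomial]

theorem monomial_eq_forestMonomial (s : T × TypedTree D T →₀ ℕ) :
    monomial s (1 : K) = forestMonomial K (Finsupp.toMultiset s) := by
  rw [monomial_eq, forestMonomial, Finsupp.toMultiset_map, Finsupp.prod_toMultiset,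
    Finsupp.prod_mapDomain_index (by simp) (by simp [pow_add])]
  simp

theorem forestMonomial_eq_monomial [DecidableEq (T × TypedTree D T)]
    (m : Multiset (T × TypedTree D T)) :
    forestMonomial K m = monomial (Multiset.toFinsupp m) 1 := by
  rw [monomial_eq_forestMonomial, Multiset.toFinsupp_toMultiset]

/-- Two linear maps on the polynomial algebra agreeing on all forest monomials are equal. -/
theorem linearMap_ext_forestMonomial {M : Type*} [AddCommGroup M] [Module K M]
    {g g' : MvPolynomial (T × TypedTree D T) K →ₗ[K] M}
    (h : ∀ m, g (forestMonomial K m) = g' (forestMonomial K m)) : g = g' := by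
  refine (basisMonomials _ K).ext fun s => ?_
  simpa [monomial_eq_forestMonomial] using h _

/-- Grafting of a forest on a common root decorated by `d`. -/
noncomputable def nodeMap (d : D) : MvPolynomial (T × TypedTree D T) K →ₗ[K] gDT K D T :=
  (basisMonomials _ K).constr K fun s => Finsupp.single (ofChildren d (Finsupp.toMultiset s)) 1

@[simp] theorem nodeMap_forestMonomial (d : D) (m : Multiset (T × TypedTree D T)) :
    nodeMap d (forestMonomial K m) = Finsupp.single (ofChildren d m) 1 := by
  classical
  have := (basisMonomials (T × TypedTree D T) K).constr_basis K
    (fun s => Finsupp.single (ofChildren d (Finsupp.toMultiset s)) (1 : K)) (Multiset.toFinsupp m)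
  rw [coe_basisMonomials] at this
  rw [forestMonomial_eq_monomial, nodeMap, this, Multiset.toFinsupp_toMultiset]

/-- The linear embedding of trees in the polynomial algebra, as children of type `t`. -/
noncomputable def edgeVar (t : T) : gDT K D T →ₗ[K] MvPolynomial (T × TypedTree D T) K :=
  Finsupp.linearCombination K fun a => X (t, a)

@[simp] theorem edgeVar_single (t : T) (a : TypedTree D T) :
    edgeVar t (Finsupp.single a (1 : K)) = X (t, a) := by
  simp [edgeVar]

theorem derivation_sum_apply {R B M ι : Type*} [CommSemiring R] [CommSemiring B] [AddCommMonoid M]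
    [Algebra R B] [Module B M] [Module R M] (s : Finset ι) (δ : ι → Derivation R B M) (x : B) :
    (∑ i ∈ s, δ i) x = ∑ i ∈ s, δ i x := by
  rw [← Derivation.coeFnAddMonoidHom_apply, map_sum, Finset.sum_apply]
  rfl

/-- The derivation of the polynomial algebra which applies the product `β · c` to one of the
children. -/
noncomputable def childDerivation (β : gDT K D T →ₗ[K] gDT K D T →ₗ[K] gDT K D T) :
    gDT K D T →ₗ[K]
      Derivation K (MvPolynomial (T × TypedTree D T) K) (MvPolynomial (T × TypedTree D T) K) :=
  (mkDerivationEquiv K).toLinearMap ∘ₗ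
    LinearMap.pi fun p => edgeVar p.1 ∘ₗ β (Finsupp.single p.2 1)

@[simp] theorem childDerivation_X (β : gDT K D T →ₗ[K] gDT K D T →ₗ[K] gDT K D T)
    (c : gDT K D T) (p : T × TypedTree D T) :
    childDerivation β c (X p) = edgeVar p.1 (β (Finsupp.single p.2 1) c) :=
  mkDerivation_X ..

theorem childDerivation_edgeVar (β : gDT K D T →ₗ[K] gDT K D T →ₗ[K] gDT K D T)
    (c x : gDT K D T) (t : T) :
    childDerivation β c (edgeVar t x) = edgeVar t (β x c) := by
  have : (childDerivation β c).toLinearMap ∘ₗ edgeVar t = edgeVar t ∘ₗ β.flip c := by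
    ext a : 1
    refine LinearMap.ext_ring ?_
    simp
  exact LinearMap.congr_fun this x

/-- The sum of all graftings of `b` on `a` with an edge of type `t`. -/
noncomputable def graftSum (K : Type) [Field K] {D T : Type} (t : T) (b a : PreTree D T) :
    gDT K D T :=
  ((graftAll t b a).map fun r => Finsupp.single (⟦r⟧ : TypedTree D T) (1 : K)).sum

/-- The sum of all graftings of `b` on the forest `l` with an edge of type `t`. -/
noncomputable def graftSumL (K : Type) [Field K] {D T : Type} (t : T) (b : PreTree D T)
    (l : List (T × PreTree D T)) : MvPolynomial (T × TypedTree D T) K :=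
  ((graftAllL t b l).map fun r => forestMonomial K (childMultiset r)).sum

theorem nodeMap_childMultiset (d : D) (l : List (T × PreTree D T)) :
    nodeMap d (forestMonomial K (childMultiset l)) =
      Finsupp.single (⟦node d l⟧ : TypedTree D T) 1 := by
  simp

theorem graftSum_node (t : T) (b : PreTree D T) (d : D) (l : List (T × PreTree D T)) :
    graftSum K t b (node d l) =
      nodeMap d (X (t, ⟦b⟧) * forestMonomial K (childMultiset l) + graftSumL K t b l) := by
  have h : X (t, ⟦b⟧) * forestMonomial K (childMultiset l) =
      forestMonomial K (childMultiset ((t, b) :: l)) := by simp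
  rw [graftSum, graftAll, map_add, h, nodeMap_childMultiset, graftSumL, map_list_sum]
  simp [Function.comp_def]

theorem graftSumL_cons (t : T) (b : PreTree D T) (u : T) (c : PreTree D T)
    (l : List (T × PreTree D T)) :
    graftSumL K t b ((u, c) :: l) =
      edgeVar u (graftSum K t b c) * forestMonomial K (childMultiset l) +
        X (u, ⟦c⟧) * graftSumL K t b l := by
  simp [graftSumL, graftAllL, graftSum, map_list_sum, Function.comp_def, List.sum_map_mul_right,
    List.sum_map_mul_left]

theorem graftSumL_append (t : T) (b : PreTree D T) (l l' : List (T × PreTree D T)) :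
    graftSumL K t b (l ++ l') =
      graftSumL K t b l * forestMonomial K (childMultiset l') +
        forestMonomial K (childMultiset l) * graftSumL K t b l' := by
  induction l with
  | nil => simp [graftSumL, graftAllL]
  | cons p l ih =>
    obtain ⟨u, c⟩ := p
    simp only [List.cons_append, graftSumL_cons, ih, childMultiset_append, forestMonomial_add,
      childMultiset_cons, forestMonomial_cons]
    ring

theorem graftSum_congr_swap (t : T) (b : PreTree D T) {a a' : PreTree D T} (h : Swap a a') :
    graftSum K t b a = graftSum K t b a' := by
  induction h with
  | swap d l₁ l₂ p q =>
    obtain ⟨u, c⟩ := p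
    obtain ⟨v, e⟩ := q
    rw [graftSum_node, graftSum_node]
    congr 1
    simp only [graftSumL_cons, graftSumL_append, childMultiset_append, forestMonomial_add,
      childMultiset_cons, forestMonomial_cons]
    ring
  | congr d l₁ l₂ u s s' h ih =>
    rw [graftSum_node, graftSum_node]
    simp only [graftSumL_cons, graftSumL_append, childMultiset_append, forestMonomial_add,
      childMultiset_cons, forestMonomial_cons, ih, h.mk_eq]

mutual
theorem graftSum_congr_right (t : T) {b b' : PreTree D T}
    (h : (⟦b⟧ : TypedTree D T) = ⟦b'⟧) : ∀ a, graftSum K t b a = graftSum K t b' a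
  | .node d l => by rw [graftSum_node, graftSum_node, h, graftSumL_congr_right t h l]
theorem graftSumL_congr_right (t : T) {b b' : PreTree D T}
    (h : (⟦b⟧ : TypedTree D T) = ⟦b'⟧) : ∀ l, graftSumL K t b l = graftSumL K t b' l
  | [] => by simp [graftSumL, graftAllL]
  | (u, c) :: l => by
    rw [graftSumL_cons, graftSumL_cons, graftSumL_congr_right t h l, graftSum_congr_right t h c]
end

theorem bulletL_single_mk (t : T) (a b : PreTree D T) :
    bulletL K t (Finsupp.single ⟦a⟧ 1) (Finsupp.single ⟦b⟧ 1) = graftSum K t b a := by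
  have h : bulletL K t (Finsupp.single ⟦a⟧ 1) (Finsupp.single ⟦b⟧ 1) =
      graftSum K t (⟦b⟧ : TypedTree D T).out (⟦a⟧ : TypedTree D T).out := by
    simp [bulletL, graftSum]
  rw [h, graftSum_congr_right t (Quotient.out_eq ⟦b⟧)]
  exact eq_of_equiv _ (fun _ _ => graftSum_congr_swap t b) (Quotient.mk_out a)

theorem graftSumL_eq_childDerivation (t : T) (b : PreTree D T) (l : List (T × PreTree D T)) :
    graftSumL K t b l =
      childDerivation (bulletL K t) (Finsupp.single ⟦b⟧ 1)
        (forestMonomial K (childMultiset l)) := by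
  induction l with
  | nil => simp [graftSumL, graftAllL]
  | cons p l ih =>
    obtain ⟨u, c⟩ := p
    simp only [graftSumL_cons, ih, childMultiset_cons, forestMonomial_cons, Derivation.leibniz,
      childDerivation_X, bulletL_single_mk, smul_eq_mul]
    ring

theorem bulletL_nodeMap (t : T) (d : D) (F : MvPolynomial (T × TypedTree D T) K)
    (c : gDT K D T) :
    bulletL K t (nodeMap d F) c =
      nodeMap d (edgeVar t c * F + childDerivation (bulletL K t) c F) := by
  induction c using Finsupp.induction_linear with
  | zero => simp
  | add c c' h h' => simp only [map_add, h, h', add_mul, Derivation.add_apply]; abel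
  | single b r =>
    rw [← mul_one r, ← smul_eq_mul, ← Finsupp.smul_single]
    simp only [map_smul, Derivation.smul_apply, smul_mul_assoc, ← smul_add]
    congr 1
    have : (bulletL K t).flip (Finsupp.single b 1) ∘ₗ nodeMap d =
        nodeMap d ∘ₗ (LinearMap.mulLeft K (edgeVar t (Finsupp.single b 1)) +
          (childDerivation (bulletL K t) (Finsupp.single b 1)).toLinearMap) := by
      refine linearMap_ext_forestMonomial fun m => ?_
      obtain ⟨l, rfl⟩ := exists_childMultiset_eq m
      induction b using Quotient.inductionOn with
      | h b =>
        simp [bulletL_single_mk, graftSum_node,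
          graftSumL_eq_childDerivation]
    exact LinearMap.congr_fun this F

/-- The weighted version of `edgeVar`. -/
noncomputable def edgeVarLam (lam : T →₀ K) :
    gDT K D T →ₗ[K] MvPolynomial (T × TypedTree D T) K :=
  lam.sum fun t r => r • edgeVar t

theorem bulletLam_apply (lam : T →₀ K) (x y : gDT K D T) :
    bulletLam K lam x y = lam.sum fun t r => r • bulletL K t x y := by
  simp [bulletLam, Finsupp.sum]

theorem edgeVarLam_apply (lam : T →₀ K) (x : gDT K D T) :
    edgeVarLam lam x = lam.sum fun t r => r • edgeVar t x := by
  simp [edgeVarLam, Finsupp.sum]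

theorem childDerivation_bulletLam (lam : T →₀ K) (c : gDT K D T) :
    childDerivation (bulletLam K lam) c =
      lam.sum fun t r => r • childDerivation (bulletL K t) c := by
  refine derivation_ext fun p => ?_
  simp [bulletLam_apply, Finsupp.sum, derivation_sum_apply]

/-- The operator grafting `c` on the root with weights `mu` and on the children through `β`. -/
noncomputable def rootGraft (β : gDT K D T →ₗ[K] gDT K D T →ₗ[K] gDT K D T) (mu : T →₀ K) :
    gDT K D T →ₗ[K] MvPolynomial (T × TypedTree D T) K →ₗ[K]
      MvPolynomial (T × TypedTree D T) K :=
  LinearMap.mk₂ K (fun c F => edgeVarLam mu c * F + childDerivation β c F)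
    (fun c c' F => by simp only [map_add, add_mul, Derivation.add_apply]; abel)
    (fun r c F => by simp)
    (fun c F F' => by simp only [map_add, mul_add]; abel)
    (fun r c F => by simp)

theorem rootGraft_apply (β : gDT K D T →ₗ[K] gDT K D T →ₗ[K] gDT K D T) (mu : T →₀ K)
    (c : gDT K D T) (F : MvPolynomial (T × TypedTree D T) K) :
    rootGraft β mu c F = edgeVarLam mu c * F + childDerivation β c F := rfl

theorem bulletLam_nodeMap (lam : T →₀ K) (d : D) (F : MvPolynomial (T × TypedTree D T) K)
    (c : gDT K D T) :
    bulletLam K lam (nodeMap d F) c = nodeMap d (rootGraft (bulletLam K lam) lam c F) := by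
  rw [rootGraft_apply, bulletLam_apply, childDerivation_bulletLam, edgeVarLam_apply]
  simp [Finsupp.sum, derivation_sum_apply, bulletL_nodeMap, Finset.sum_mul,
    Finset.sum_add_distrib]

end
end TypedTree

namespace TypedTree
section
variable {K D T : Type} [Field K]
open PreTree MvPolynomial

theorem childDerivation_edgeVarLam (β : gDT K D T →ₗ[K] gDT K D T →ₗ[K] gDT K D T)
    (mu : T →₀ K) (c x : gDT K D T) :
    childDerivation β c (edgeVarLam mu x) = edgeVarLam mu (β x c) := by
  simp [edgeVarLam_apply, Finsupp.sum, childDerivation_edgeVar]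

theorem rootGraft_prelie {β : gDT K D T →ₗ[K] gDT K D T →ₗ[K] gDT K D T} (mu : T →₀ K)
    (y z : gDT K D T) (F : MvPolynomial (T × TypedTree D T) K)
    (h : ⁅childDerivation β z, childDerivation β y⁆ F = childDerivation β (β y z - β z y) F) :
    rootGraft β mu z (rootGraft β mu y F) - rootGraft β mu (β y z) F =
      rootGraft β mu y (rootGraft β mu z F) - rootGraft β mu (β z y) F := by
  simp only [Derivation.commutator_apply, map_sub, Derivation.sub_apply] at h
  simp only [rootGraft_apply, map_add, Derivation.leibniz, childDerivation_edgeVarLam,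
    smul_eq_mul]
  linear_combination h

theorem edgeVar_prelie {β : gDT K D T →ₗ[K] gDT K D T →ₗ[K] gDT K D T} (y z : gDT K D T)
    (p : T × TypedTree D T)
    (h : β (β (Finsupp.single p.2 1) y) z - β (Finsupp.single p.2 1) (β y z) =
      β (β (Finsupp.single p.2 1) z) y - β (Finsupp.single p.2 1) (β z y)) :
    ⁅childDerivation β z, childDerivation β y⁆ (X p) =
      childDerivation β (β y z - β z y) (X p) := by
  simp only [Derivation.commutator_apply, childDerivation_X, childDerivation_edgeVar]
  rw [← map_sub]
  congr 1
  rw [map_sub, sub_eq_sub_iff_sub_eq_sub]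
  exact h

theorem derivation_eq_forestMonomial
    {δ δ' : Derivation K (MvPolynomial (T × TypedTree D T) K)
      (MvPolynomial (T × TypedTree D T) K)} {m : Multiset (T × TypedTree D T)}
    (h : ∀ p ∈ m, δ (X p) = δ' (X p)) : δ (forestMonomial K m) = δ' (forestMonomial K m) := by
  induction m using Multiset.induction_on with
  | empty => simp
  | cons p m ih =>
    simp only [forestMonomial_cons, Derivation.leibniz, h p (Multiset.mem_cons_self p m),
      ih fun q hq => h q (Multiset.mem_cons_of_mem hq)]

theorem bulletLam_single_prelie (lam : T →₀ K) (a : TypedTree D T) (y z : gDT K D T) :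
    bulletLam K lam (bulletLam K lam (Finsupp.single a 1) y) z -
        bulletLam K lam (Finsupp.single a 1) (bulletLam K lam y z) =
      bulletLam K lam (bulletLam K lam (Finsupp.single a 1) z) y -
        bulletLam K lam (Finsupp.single a 1) (bulletLam K lam z y) := by
  induction a using induction_children with
  | h d m ih =>
    rw [← nodeMap_forestMonomial]
    simp only [bulletLam_nodeMap, ← map_sub]
    exact congrArg _ (rootGraft_prelie lam y z _ (derivation_eq_forestMonomial fun p hp =>
      edgeVar_prelie y z p (ih p hp)))

theorem rootGraft_bulletLam_prelie (lam mu : T →₀ K) (y z : gDT K D T)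
    (F : MvPolynomial (T × TypedTree D T) K) :
    rootGraft (bulletLam K lam) mu z (rootGraft (bulletLam K lam) mu y F) -
        rootGraft (bulletLam K lam) mu (bulletLam K lam y z) F =
      rootGraft (bulletLam K lam) mu y (rootGraft (bulletLam K lam) mu z F) -
        rootGraft (bulletLam K lam) mu (bulletLam K lam z y) F := by
  refine rootGraft_prelie mu y z F ?_
  congr 1
  exact derivation_ext fun p => edgeVar_prelie y z p (bulletLam_single_prelie lam p.2 y z)

theorem rootGraft_edgeVar_mul (β : gDT K D T →ₗ[K] gDT K D T →ₗ[K] gDT K D T) (mu : T →₀ K)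
    (t : T) (x c : gDT K D T) (F : MvPolynomial (T × TypedTree D T) K) :
    rootGraft β mu c (edgeVar t x * F) =
      edgeVar t x * rootGraft β mu c F + edgeVar t (β x c) * F := by
  simp only [rootGraft_apply, Derivation.leibniz, childDerivation_edgeVar, smul_eq_mul]
  ring

theorem rootGraft_eq_erase (β : gDT K D T →ₗ[K] gDT K D T →ₗ[K] gDT K D T) (lam : T →₀ K)
    (t0 : T) (c : gDT K D T) (F : MvPolynomial (T × TypedTree D T) K) :
    rootGraft β lam c F =
      lam t0 • (edgeVar t0 c * F) + rootGraft β (lam.erase t0) c F := by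
  have : edgeVarLam lam c = lam t0 • edgeVar t0 c + edgeVarLam (lam.erase t0) c := by
    conv_lhs => rw [← Finsupp.single_add_erase t0 lam, edgeVarLam_apply]
    rw [Finsupp.sum_add_index' (by simp) (by simp [add_smul]), Finsupp.sum_single_index (by simp),
      ← edgeVarLam_apply]
  rw [rootGraft_apply, rootGraft_apply, this, add_mul, smul_mul_assoc, add_assoc]

/-- The span of the trees with `n` vertices. -/
def sizeSubmodule (K D T : Type) [Field K] (n : ℕ) : Submodule K (gDT K D T) :=
  Finsupp.supported K K {a | numVertices a = n}

theorem single_mem_sizeSubmodule (a : TypedTree D T) (r : K) :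
    Finsupp.single a r ∈ sizeSubmodule K D T (numVertices a) :=
  Finsupp.single_mem_supported K r rfl

theorem sizeSubmodule_le {n : ℕ} {S : Submodule K (gDT K D T)}
    (h : ∀ a, numVertices a = n → Finsupp.single a 1 ∈ S) : sizeSubmodule K D T n ≤ S := by
  rw [sizeSubmodule, Finsupp.supported_eq_span_single, Submodule.span_le]
  rintro _ ⟨a, ha, rfl⟩
  exact h a ha

theorem bulletL_mem_sizeSubmodule (t : T) {m n : ℕ} {x y : gDT K D T}
    (hx : x ∈ sizeSubmodule K D T m) (hy : y ∈ sizeSubmodule K D T n) :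
    bulletL K t x y ∈ sizeSubmodule K D T (m + n) := by
  suffices h : sizeSubmodule K D T m ≤
      (sizeSubmodule K D T (m + n)).comap ((bulletL K t).flip y) from h hx
  refine sizeSubmodule_le fun a ha => ?_
  suffices h : sizeSubmodule K D T n ≤
      (sizeSubmodule K D T (m + n)).comap (bulletL K t (Finsupp.single a 1)) from h hy
  refine sizeSubmodule_le fun b hb => ?_
  induction a using Quotient.inductionOn with
  | h a =>
    induction b using Quotient.inductionOn with
    | h b =>
      rw [Submodule.mem_comap, bulletL_single_mk, graftSum]
      refine list_sum_mem fun x hx => ?_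
      obtain ⟨r, hr, rfl⟩ := List.mem_map.1 hx
      refine Finsupp.single_mem_supported K _ ?_
      change vertexCount r = _
      rw [vertexCount_of_mem_graftAll t b a r hr]
      exact congrArg₂ (· + ·) ha hb

theorem bulletLam_mem_sizeSubmodule (lam : T →₀ K) {m n : ℕ} {x y : gDT K D T}
    (hx : x ∈ sizeSubmodule K D T m) (hy : y ∈ sizeSubmodule K D T n) :
    bulletLam K lam x y ∈ sizeSubmodule K D T (m + n) := by
  rw [bulletLam_apply]
  exact Submodule.sum_mem _ fun t _ =>
    Submodule.smul_mem _ _ (bulletL_mem_sizeSubmodule t hx hy)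

open Classical in
/-- The weight of a child: its number of vertices, and whether its edge has type `t0`. -/
noncomputable def childWeight (t0 : T) (p : T × TypedTree D T) : ℕ × ℕ :=
  (numVertices p.2, if p.1 = t0 then 1 else 0)

/-- The total weight of a forest. -/
noncomputable def forestWeight (t0 : T) (m : Multiset (T × TypedTree D T)) : ℕ × ℕ :=
  (m.map (childWeight t0)).sum

@[simp] theorem forestWeight_zero (t0 : T) :
    forestWeight t0 (0 : Multiset (T × TypedTree D T)) = 0 := by
  simp [forestWeight]

@[simp] theorem forestWeight_cons (t0 : T) (p : T × TypedTree D T)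
    (m : Multiset (T × TypedTree D T)) :
    forestWeight t0 (p ::ₘ m) = childWeight t0 p + forestWeight t0 m := by
  simp [forestWeight]

theorem numVertices_eq_forestWeight (t0 : T) (a : TypedTree D T) :
    numVertices a = 1 + (forestWeight t0 (children a)).1 := by
  conv_lhs => rw [← ofChildren_rootDec_children a, numVertices_ofChildren]
  congr 1
  induction children a using Multiset.induction_on with
  | empty => simp
  | cons p m ih => simp [ih, childWeight]

/-- The span of the forests of given weight. -/
noncomputable abbrev weightSubmodule (K : Type) [Field K] {D T : Type} (t0 : T) (k : ℕ × ℕ) :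
    Submodule K (MvPolynomial (T × TypedTree D T) K) :=
  weightedHomogeneousSubmodule K (childWeight t0) k

theorem forestMonomial_mem_weightSubmodule (t0 : T) (m : Multiset (T × TypedTree D T)) :
    forestMonomial K m ∈ weightSubmodule K t0 (forestWeight t0 m) := by
  induction m using Multiset.induction_on with
  | empty => simpa using isWeightedHomogeneous_one K _
  | cons p m ih =>
    rw [forestMonomial_cons, forestWeight_cons]
    exact (isWeightedHomogeneous_X K _ p).mul ih

theorem forestWeight_toMultiset (t0 : T) (s : T × TypedTree D T →₀ ℕ) :
    forestWeight t0 (Finsupp.toMultiset s) = Finsupp.weight (childWeight t0) s := by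
  induction s using Finsupp.induction_linear with
  | zero => simp
  | add s s' h h' => simp only [map_add, ← h, ← h', forestWeight, Multiset.map_add,
      Multiset.sum_add]
  | single p n => simp [forestWeight, Finsupp.weight_single, Multiset.map_nsmul, Multiset.sum_nsmul]

theorem weightSubmodule_le {t0 : T} {k : ℕ × ℕ}
    {S : Submodule K (MvPolynomial (T × TypedTree D T) K)}
    (h : ∀ m, forestWeight t0 m = k → forestMonomial K m ∈ S) : weightSubmodule K t0 k ≤ S := by
  intro F hF
  rw [F.as_sum]
  refine Submodule.sum_mem _ fun s hs => ?_
  rw [← mul_one (coeff s F), ← smul_eq_mul, ← smul_monomial, monomial_eq_forestMonomial]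
  refine Submodule.smul_mem _ _ (h _ ?_)
  rw [← hF (mem_support_iff.1 hs), forestWeight_toMultiset]

theorem edgeVar_mem_weightSubmodule {t0 t : T} (ht : t ≠ t0) {n : ℕ} {c : gDT K D T}
    (hc : c ∈ sizeSubmodule K D T n) : edgeVar t c ∈ weightSubmodule K t0 (n, 0) := by
  suffices h : sizeSubmodule K D T n ≤ (weightSubmodule K t0 (n, 0)).comap (edgeVar t) from h hc
  refine sizeSubmodule_le fun a ha => ?_
  rw [Submodule.mem_comap, edgeVar_single]
  have := isWeightedHomogeneous_X K (childWeight t0) (t, a)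
  rwa [childWeight, if_neg ht, ha] at this

theorem childDerivation_mem_weightSubmodule (lam : T →₀ K) (t0 : T) {n : ℕ} {c : gDT K D T}
    (hc : c ∈ sizeSubmodule K D T n) {k : ℕ × ℕ} {F : MvPolynomial (T × TypedTree D T) K}
    (hF : F ∈ weightSubmodule K t0 k) :
    childDerivation (bulletLam K lam) c F ∈ weightSubmodule K t0 (k + (n, 0)) := by
  suffices h : weightSubmodule K t0 k ≤ (weightSubmodule K t0 (k + (n, 0))).comap
      (childDerivation (bulletLam K lam) c).toLinearMap from h hF
  refine weightSubmodule_le fun m hm => ?_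
  rw [Submodule.mem_comap]
  subst hm
  clear hF
  change childDerivation (bulletLam K lam) c (forestMonomial K m) ∈ _
  induction m using Multiset.induction_on with
  | empty => simp
  | cons p m ih =>
    rw [forestMonomial_cons, Derivation.leibniz, forestWeight_cons, childDerivation_X]
    refine Submodule.add_mem _ ?_ ?_
    · rw [add_assoc]
      exact (isWeightedHomogeneous_X K _ p).mul ih
    · have hX : edgeVar p.1 (bulletLam K lam (Finsupp.single p.2 1) c) ∈
          weightSubmodule K t0 (childWeight t0 p + (n, 0)) := by
        suffices h : sizeSubmodule K D T (numVertices p.2 + n) ≤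
            (weightSubmodule K t0 (childWeight t0 p + (n, 0))).comap (edgeVar p.1) from
          h (bulletLam_mem_sizeSubmodule lam (single_mem_sizeSubmodule _ _) hc)
        refine sizeSubmodule_le fun a ha => ?_
        rw [Submodule.mem_comap, edgeVar_single]
        have := isWeightedHomogeneous_X K (childWeight t0) (p.1, a)
        rw [childWeight, ha] at this
        simpa [childWeight] using this
      have := (forestMonomial_mem_weightSubmodule (K := K) t0 m).mul hX
      rwa [← add_assoc, add_comm (forestWeight t0 m)] at this

theorem rootGraft_mem_weightSubmodule (lam : T →₀ K) {mu : T →₀ K} {t0 : T} (hmu : mu t0 = 0)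
    {n : ℕ} {c : gDT K D T} (hc : c ∈ sizeSubmodule K D T n) {k : ℕ × ℕ}
    {F : MvPolynomial (T × TypedTree D T) K} (hF : F ∈ weightSubmodule K t0 k) :
    rootGraft (bulletLam K lam) mu c F ∈ weightSubmodule K t0 (k + (n, 0)) := by
  refine Submodule.add_mem _ ?_ (childDerivation_mem_weightSubmodule lam t0 hc hF)
  rw [mul_comm]
  refine IsWeightedHomogeneous.mul hF ?_
  rw [edgeVarLam_apply]
  refine Submodule.sum_mem (weightSubmodule K t0 (n, 0)) fun t ht => Submodule.smul_mem _ _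
    (edgeVar_mem_weightSubmodule ?_ hc)
  rintro rfl
  exact Finsupp.mem_support_iff.1 ht hmu

theorem nodeMap_mem_supported {t0 : T} (d : D) {k : ℕ × ℕ}
    {F : MvPolynomial (T × TypedTree D T) K} (hF : F ∈ weightSubmodule K t0 k) :
    nodeMap d F ∈ Finsupp.supported K K {a | forestWeight t0 (children a) = k} := by
  suffices h : weightSubmodule K t0 k ≤ (Finsupp.supported K K
      {a | forestWeight t0 (children a) = k}).comap (nodeMap d) from h hF
  refine weightSubmodule_le fun m hm => ?_
  rw [Submodule.mem_comap, nodeMap_forestMonomial]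
  exact Finsupp.single_mem_supported K _ (by simpa using hm)

end
end TypedTree

namespace TypedTree
section
variable {K D T : Type} [Field K] {A : Type} [AddCommGroup A] [Module K A]
open PreTree MvPolynomial

/-- The defect, for a linear map `φ`, of the relation expressing the tree obtained by attaching `c`
to the root with type `t0` in terms of trees with fewer root edges of type `t0`. -/
noncomputable def graftDefect (lam : T →₀ K) (t0 : T) (mulA : A →ₗ[K] A →ₗ[K] A)
    (φ : gDT K D T →ₗ[K] A) (d : D) :
    gDT K D T →ₗ[K] MvPolynomial (T × TypedTree D T) K →ₗ[K] A :=
  LinearMap.mk₂ K (fun c F => lam t0 • φ (nodeMap d (edgeVar t0 c * F)) -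
      (mulA (φ (nodeMap d F)) (φ c) -
        φ (nodeMap d (rootGraft (bulletLam K lam) (lam.erase t0) c F))))
    (fun c c' F => by
      simp only [map_add, add_mul, LinearMap.add_apply, smul_add]; abel)
    (fun r c F => by
      simp only [map_smul, smul_mul_assoc, LinearMap.smul_apply, smul_sub, smul_comm r])
    (fun c F F' => by
      simp only [map_add, mul_add, LinearMap.add_apply, smul_add]; abel)
    (fun r c F => by
      simp only [map_smul, mul_smul_comm, LinearMap.smul_apply, smul_sub, smul_comm r])

theorem graftDefect_eq_zero_iff {lam : T →₀ K} {t0 : T} {mulA : A →ₗ[K] A →ₗ[K] A}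
    {φ : gDT K D T →ₗ[K] A} {d : D} {c : gDT K D T} {F : MvPolynomial (T × TypedTree D T) K} :
    graftDefect lam t0 mulA φ d c F = 0 ↔
      lam t0 • φ (nodeMap d (edgeVar t0 c * F)) = mulA (φ (nodeMap d F)) (φ c) -
        φ (nodeMap d (rootGraft (bulletLam K lam) (lam.erase t0) c F)) :=
  sub_eq_zero

theorem graftDefect_eq_zero_iff_map_bulletLam {lam : T →₀ K} {t0 : T}
    {mulA : A →ₗ[K] A →ₗ[K] A} {φ : gDT K D T →ₗ[K] A} {d : D} {c : gDT K D T}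
    {F : MvPolynomial (T × TypedTree D T) K} :
    graftDefect lam t0 mulA φ d c F = 0 ↔
      φ (bulletLam K lam (nodeMap d F) c) = mulA (φ (nodeMap d F)) (φ c) := by
  rw [graftDefect_eq_zero_iff, bulletLam_nodeMap, rootGraft_eq_erase _ lam t0, map_add, map_add,
    map_smul, map_smul, eq_sub_iff_add_eq]

theorem graftDefect_vanishing {lam : T →₀ K} {t0 : T} {mulA : A →ₗ[K] A →ₗ[K] A}
    {φ : gDT K D T →ₗ[K] A} {d : D} {n : ℕ} {k : ℕ × ℕ}
    (h : ∀ a m, numVertices a = n → forestWeight t0 m = k →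
      graftDefect lam t0 mulA φ d (Finsupp.single a 1) (forestMonomial K m) = 0)
    {c : gDT K D T} (hc : c ∈ sizeSubmodule K D T n)
    {F : MvPolynomial (T × TypedTree D T) K} (hF : F ∈ weightSubmodule K t0 k) :
    graftDefect lam t0 mulA φ d c F = 0 := by
  suffices hle : sizeSubmodule K D T n ≤
      LinearMap.ker ((graftDefect lam t0 mulA φ d).flip F) from hle hc
  refine sizeSubmodule_le fun a ha => ?_
  suffices hle : weightSubmodule K t0 k ≤
      LinearMap.ker (graftDefect lam t0 mulA φ d (Finsupp.single a 1)) from hle hF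
  exact weightSubmodule_le fun m hm => h a m ha hm

/-- The two ways of reducing a tree with two root edges of type `t0` agree. -/
theorem reduction_symm {lam : T →₀ K} {t0 : T} (h0 : lam t0 ≠ 0) {mulA : A →ₗ[K] A →ₗ[K] A}
    (hA : ∀ x y z : A,
      mulA x (mulA y z) - mulA (mulA x y) z = mulA x (mulA z y) - mulA (mulA x z) y)
    {φ : gDT K D T →ₗ[K] A} {d : D} {c c' : gDT K D T}
    {F : MvPolynomial (T × TypedTree D T) K}
    (h₁ : graftDefect lam t0 mulA φ d c F = 0) (h₁' : graftDefect lam t0 mulA φ d c' F = 0)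
    (h₂ : graftDefect lam t0 mulA φ d c
      (rootGraft (bulletLam K lam) (lam.erase t0) c' F) = 0)
    (h₂' : graftDefect lam t0 mulA φ d c'
      (rootGraft (bulletLam K lam) (lam.erase t0) c F) = 0)
    (h₃ : graftDefect lam t0 mulA φ d (bulletLam K lam c c') F = 0)
    (h₃' : graftDefect lam t0 mulA φ d (bulletLam K lam c' c) F = 0)
    (h₄ : φ (bulletLam K lam c c') = mulA (φ c) (φ c'))
    (h₄' : φ (bulletLam K lam c' c) = mulA (φ c') (φ c)) :
    mulA (φ (nodeMap d (edgeVar t0 c * F))) (φ c') -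
        φ (nodeMap d (rootGraft (bulletLam K lam) (lam.erase t0) c' (edgeVar t0 c * F))) =
      mulA (φ (nodeMap d (edgeVar t0 c' * F))) (φ c) -
        φ (nodeMap d (rootGraft (bulletLam K lam) (lam.erase t0) c (edgeVar t0 c' * F))) := by
  rw [graftDefect_eq_zero_iff] at h₁ h₁' h₂ h₂' h₃ h₃'
  refine smul_right_injective A h0 ?_
  have hF := congrArg (fun G => φ (nodeMap d G))
    (rootGraft_bulletLam_prelie lam (lam.erase t0) c c' F)
  have hAF := hA (φ (nodeMap d F)) (φ c) (φ c')
  simp only [map_sub] at hF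
  simp only [rootGraft_edgeVar_mul, map_add, smul_sub, smul_add, ← LinearMap.smul_apply,
    ← map_smul mulA, h₁, h₁']
  simp only [LinearMap.smul_apply, h₂, h₂', h₃, h₃', h₄, h₄', map_sub, LinearMap.sub_apply]
  rw [← sub_eq_zero] at hF hAF ⊢
  have hsum := congrArg₂ (fun u v => -(u + v)) hF hAF
  simp only [add_zero, neg_zero] at hsum
  rw [← hsum]
  abel

open Classical in
/-- The recursive extension to all trees of a map defined on the trees without root edge of type
`t0`. -/
noncomputable def freeExtension (lam : T →₀ K) (t0 : T) (mulA : A →ₗ[K] A →ₗ[K] A)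
    (f : TypedTree D T → A) (a : TypedTree D T) : A :=
  if h : ∃ q : TypedTree D T × Multiset (T × TypedTree D T),
      children a = (t0, q.1) ::ₘ q.2 then
    (lam t0)⁻¹ • (mulA
      (freeExtension lam t0 mulA f (ofChildren (rootDec a) h.choose.2))
      (freeExtension lam t0 mulA f h.choose.1) -
      ∑ r ∈ (nodeMap (rootDec a) (rootGraft (bulletLam K lam) (lam.erase t0)
          (Finsupp.single h.choose.1 1) (forestMonomial K h.choose.2))).support.attach,
        nodeMap (rootDec a) (rootGraft (bulletLam K lam) (lam.erase t0)
          (Finsupp.single h.choose.1 1) (forestMonomial K h.choose.2)) r.1 •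
        freeExtension lam t0 mulA f r.1)
  else f a
termination_by ((forestWeight t0 (children a)).1, (forestWeight t0 (children a)).2)
decreasing_by
  · rw [congrArg (forestWeight t0) h.choose_spec]
    refine Prod.Lex.left _ _ ?_
    have := numVertices_pos h.choose.1
    simp only [children_ofChildren, forestWeight_cons, childWeight, Prod.fst_add]
    omega
  · rw [congrArg (forestWeight t0) h.choose_spec]
    refine Prod.Lex.left _ _ ?_
    have := numVertices_eq_forestWeight t0 h.choose.1
    simp only [forestWeight_cons, childWeight, Prod.fst_add]
    omega
  · have hr : forestWeight t0 (children r.1) =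
        forestWeight t0 h.choose.2 + (numVertices h.choose.1, 0) :=
      nodeMap_mem_supported _ (rootGraft_mem_weightSubmodule lam Finsupp.erase_same
        (single_mem_sizeSubmodule _ _) (forestMonomial_mem_weightSubmodule _ _)) r.2
    rw [congrArg (forestWeight t0) h.choose_spec, hr, Prod.lex_def]
    refine Or.inr ?_
    simp only [forestWeight_cons, childWeight, Prod.fst_add, Prod.snd_add, if_pos]
    omega

theorem freeExtension_of_forall_ne (lam : T →₀ K) {t0 : T} (mulA : A →ₗ[K] A →ₗ[K] A)
    (f : TypedTree D T → A) {a : TypedTree D T} (ha : ∀ p ∈ children a, p.1 ≠ t0) :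
    freeExtension lam t0 mulA f a = f a := by
  rw [freeExtension, dif_neg]
  rintro ⟨q, hq⟩
  exact ha (t0, q.1) (hq ▸ Multiset.mem_cons_self _ _) rfl

theorem exists_graftDefect_eq_zero {lam : T →₀ K} {t0 : T} (h0 : lam t0 ≠ 0)
    (mulA : A →ₗ[K] A →ₗ[K] A) (f : TypedTree D T → A) (d : D)
    {p : T × TypedTree D T} {m : Multiset (T × TypedTree D T)} (hp : p ∈ m) (ht : p.1 = t0) :
    ∃ c m', m = (t0, c) ::ₘ m' ∧
      graftDefect lam t0 mulA (Finsupp.linearCombination K (freeExtension lam t0 mulA f)) d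
        (Finsupp.single c 1) (forestMonomial K m') = 0 := by
  have h : ∃ q : TypedTree D T × Multiset (T × TypedTree D T),
      children (ofChildren d m) = (t0, q.1) ::ₘ q.2 := by
    obtain ⟨m', rfl⟩ := Multiset.exists_cons_of_mem hp
    exact ⟨(p.2, m'), by simp [← ht]⟩
  have hm : m = (t0, h.choose.1) ::ₘ h.choose.2 := by
    rw [← h.choose_spec, children_ofChildren]
  refine ⟨h.choose.1, h.choose.2, hm, ?_⟩
  rw [graftDefect_eq_zero_iff, edgeVar_single, ← forestMonomial_cons, ← hm,
    nodeMap_forestMonomial, Finsupp.linearCombination_single, one_smul, freeExtension, dif_pos h,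
    smul_inv_smul₀ h0, nodeMap_forestMonomial, Finsupp.linearCombination_single, one_smul,
    Finsupp.linearCombination_single, one_smul, Finsupp.linearCombination_apply, Finsupp.sum,
    rootDec_ofChildren]
  exact congrArg _ (Finset.sum_attach _ fun r => nodeMap d _ r • freeExtension lam t0 mulA f r)

theorem graftDefect_freeExtension {lam : T →₀ K} {t0 : T} (h0 : lam t0 ≠ 0)
    {mulA : A →ₗ[K] A →ₗ[K] A}
    (hA : ∀ x y z : A,
      mulA x (mulA y z) - mulA (mulA x y) z = mulA x (mulA z y) - mulA (mulA x z) y)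
    (f : TypedTree D T → A) (k : ℕ ×ₗ ℕ) :
    ∀ (d : D) (n : ℕ) (l : ℕ × ℕ), toLex (l.1 + n, l.2) = k → ∀ c ∈ sizeSubmodule K D T n,
      ∀ F ∈ weightSubmodule K t0 l, graftDefect lam t0 mulA
        (Finsupp.linearCombination K (freeExtension lam t0 mulA f)) d c F = 0 := by
  induction k using WellFoundedLT.induction with
  | ind k ih =>
    set φ : gDT K D T →ₗ[K] A := Finsupp.linearCombination K (freeExtension lam t0 mulA f)
      with hφ
    rintro d n l rfl c hc F hF
    refine graftDefect_vanishing (fun a m ha hm => ?_) hc hF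
    clear hc hF
    obtain ⟨c', m', hm', hdef⟩ := exists_graftDefect_eq_zero h0 mulA f d
      (Multiset.mem_cons_self (t0, a) m) rfl
    rw [← hφ] at hdef
    rcases Multiset.cons_eq_cons.1 hm' with ⟨hac, rfl⟩ | ⟨-, m'', rfl, rfl⟩
    · rw [(Prod.mk.inj hac).2]
      exact hdef
    have hweight : l = (numVertices c' + (forestWeight t0 m'').1,
        1 + (forestWeight t0 m'').2) := by
      rw [← hm, forestWeight_cons, childWeight, if_pos rfl]
      rfl
    have hlt : ∀ (d : D) (n' : ℕ) (l' : ℕ × ℕ),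
        toLex (l'.1 + n', l'.2) < toLex (l.1 + n, l.2) →
        ∀ x ∈ sizeSubmodule K D T n', ∀ G ∈ weightSubmodule K t0 l',
          graftDefect lam t0 mulA φ d x G = 0 :=
      fun d n' l' h => ih _ h d n' l' rfl
    have hsa := single_mem_sizeSubmodule a (1 : K)
    have hsc := single_mem_sizeSubmodule c' (1 : K)
    have hF := forestMonomial_mem_weightSubmodule (K := K) t0 m''
    have hapos := numVertices_pos a
    have hcpos := numVertices_pos c'
    have key := reduction_symm h0 hA (φ := φ) (d := d) (c := Finsupp.single a 1)
      (c' := Finsupp.single c' 1) (F := forestMonomial K m'')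
      (hlt _ _ _ (by simp [Prod.Lex.toLex_lt_toLex, hweight]; omega) _ hsa _ hF)
      (hlt _ _ _ (by simp [Prod.Lex.toLex_lt_toLex, hweight]; omega) _ hsc _ hF)
      (hlt _ _ _ (by simp [Prod.Lex.toLex_lt_toLex, hweight]; omega) _ hsa _
        (rootGraft_mem_weightSubmodule lam Finsupp.erase_same hsc hF))
      (hlt _ _ _ (by simp [Prod.Lex.toLex_lt_toLex, hweight]; omega) _ hsc _
        (rootGraft_mem_weightSubmodule lam Finsupp.erase_same hsa hF))
      (hlt _ _ _ (by simp [Prod.Lex.toLex_lt_toLex, hweight]; omega) _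
        (bulletLam_mem_sizeSubmodule lam hsa hsc) _ hF)
      (hlt _ _ _ (by simp [Prod.Lex.toLex_lt_toLex, hweight]; omega) _
        (bulletLam_mem_sizeSubmodule lam hsc hsa) _ hF)
      (by
        have := numVertices_eq_forestWeight t0 a
        rw [← ofChildren_rootDec_children a, ← nodeMap_forestMonomial,
          ← graftDefect_eq_zero_iff_map_bulletLam (t0 := t0)]
        exact hlt _ _ _ (by simp [Prod.Lex.toLex_lt_toLex, hweight]; omega) _ hsc _
          (forestMonomial_mem_weightSubmodule _ _))
      (by
        have := numVertices_eq_forestWeight t0 c'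
        rw [← ofChildren_rootDec_children c', ← nodeMap_forestMonomial,
          ← graftDefect_eq_zero_iff_map_bulletLam (t0 := t0)]
        exact hlt _ _ _ (by simp [Prod.Lex.toLex_lt_toLex, hweight]; omega) _ hsa _
          (forestMonomial_mem_weightSubmodule _ _))
    rw [graftDefect_eq_zero_iff] at hdef ⊢
    simp only [edgeVar_single, forestMonomial_cons] at key hdef ⊢
    rw [← key, ← hdef, mul_left_comm]

/-- Every linear map on `gDT` whose defects vanish is multiplicative. -/
theorem map_bulletLam_of_graftDefect {lam : T →₀ K} {t0 : T} {mulA : A →ₗ[K] A →ₗ[K] A}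
    {φ : gDT K D T →ₗ[K] A}
    (h : ∀ d a m, graftDefect lam t0 mulA φ d (Finsupp.single a 1) (forestMonomial K m) = 0)
    (x y : gDT K D T) : φ (bulletLam K lam x y) = mulA (φ x) (φ y) := by
  have : (bulletLam K lam).compr₂ φ = mulA.compl₁₂ φ φ := by
    ext a : 1
    refine LinearMap.ext_ring ?_
    ext b : 1
    refine LinearMap.ext_ring ?_
    have := graftDefect_eq_zero_iff_map_bulletLam.1 (h (rootDec a) b (children a))
    simpa using this
  exact LinearMap.congr_fun₂ this x y

/-- Multiplicative maps are determined by their values on the trees without root edge of type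
`t0`. -/
theorem hom_ext_of_noRootEdge {lam : T →₀ K} {t0 : T} (h0 : lam t0 ≠ 0)
    {mulA : A →ₗ[K] A →ₗ[K] A} {φ ψ : gDT K D T →ₗ[K] A}
    (hφ : ∀ x y, φ (bulletLam K lam x y) = mulA (φ x) (φ y))
    (hψ : ∀ x y, ψ (bulletLam K lam x y) = mulA (ψ x) (ψ y))
    (h : ∀ a, NoRootEdge t0 a → φ (Finsupp.single a 1) = ψ (Finsupp.single a 1)) : φ = ψ := by
  suffices hk : ∀ (k : ℕ ×ₗ ℕ) (a : TypedTree D T), toLex (forestWeight t0 (children a)) = k →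
      φ (Finsupp.single a 1) = ψ (Finsupp.single a 1) by
    ext a : 1
    exact LinearMap.ext_ring (hk _ a rfl)
  intro k
  induction k using WellFoundedLT.induction with
  | ind k ih =>
    rintro a rfl
    by_cases ha : NoRootEdge t0 a
    · exact h a ha
    rw [noRootEdge_iff] at ha
    push Not at ha
    obtain ⟨⟨t, c⟩, hp, rfl⟩ := ha
    obtain ⟨m, hm⟩ := Multiset.exists_cons_of_mem hp
    have hpos := numVertices_pos c
    have hc := numVertices_eq_forestWeight t c
    have hw : forestWeight t (children a) =
        (numVertices c + (forestWeight t m).1, 1 + (forestWeight t m).2) := by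
      rw [hm, forestWeight_cons, childWeight, if_pos rfl]
      rfl
    have h₁ : φ (Finsupp.single c 1) = ψ (Finsupp.single c 1) :=
      ih _ (by rw [hw, Prod.Lex.toLex_lt_toLex]; left; simp only; omega) c rfl
    have h₂ : φ (nodeMap (rootDec a) (forestMonomial K m)) =
        ψ (nodeMap (rootDec a) (forestMonomial K m)) := by
      rw [nodeMap_forestMonomial]
      exact ih _ (by rw [hw, Prod.Lex.toLex_lt_toLex, children_ofChildren]; left; simp only; omega)
        _ rfl
    have h₃ : φ (nodeMap (rootDec a) (rootGraft (bulletLam K lam) (lam.erase t)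
          (Finsupp.single c 1) (forestMonomial K m))) =
        ψ (nodeMap (rootDec a) (rootGraft (bulletLam K lam) (lam.erase t)
          (Finsupp.single c 1) (forestMonomial K m))) := by
      have hmem := nodeMap_mem_supported (rootDec a)
        (rootGraft_mem_weightSubmodule lam (Finsupp.erase_same (f := lam) (a := t))
          (single_mem_sizeSubmodule c (1 : K)) (forestMonomial_mem_weightSubmodule t m))
      refine (?_ : _ ≤ LinearMap.eqLocus φ ψ) hmem
      rw [Finsupp.supported_eq_span_single, Submodule.span_le]
      rintro _ ⟨b, hb, rfl⟩
      refine ih _ ?_ b rfl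
      rw [hb, hw, Prod.Lex.toLex_lt_toLex]
      right
      simp only [Prod.fst_add, Prod.snd_add]
      omega
    have hφ' := graftDefect_eq_zero_iff.1 ((graftDefect_eq_zero_iff_map_bulletLam (t0 := t)).2
      (hφ (nodeMap (rootDec a) (forestMonomial K m)) (Finsupp.single c 1)))
    have hψ' := graftDefect_eq_zero_iff.1 ((graftDefect_eq_zero_iff_map_bulletLam (t0 := t)).2
      (hψ (nodeMap (rootDec a) (forestMonomial K m)) (Finsupp.single c 1)))
    rw [edgeVar_single, ← forestMonomial_cons, ← hm, nodeMap_forestMonomial,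
      ofChildren_rootDec_children] at hφ' hψ'
    refine smul_right_injective A h0 ?_
    change lam t • _ = lam t • _
    rw [hφ', hψ', h₁, h₂, h₃]

end
end TypedTree

/-- If `λ ∈ K^{(𝒯)}` and `λ_{t0} ≠ 0`, then the prelie algebra
`(g_{D,𝒯}, •_λ)` is freely generated by the set `T^{(t0)}_{D,𝒯}` of trees having no edge of
type `t0` incident to the root. -/
theorem gDT_bulletLam_free_prelie (K : Type) [Field K] (D T : Type) [Nonempty D] [Nonempty T]
    (lam : T →₀ K) (t0 : T) (h : lam t0 ≠ 0)
    (A : Type) [AddCommGroup A] [Module K A] (mulA : A →ₗ[K] A →ₗ[K] A)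
    (hA : ∀ x y z : A,
      mulA x (mulA y z) - mulA (mulA x y) z = mulA x (mulA z y) - mulA (mulA x z) y)
    (f : {x : TypedTree D T // NoRootEdge t0 x} → A) :
    ∃! φ : gDT K D T →ₗ[K] A,
      (∀ x y : gDT K D T, φ (bulletLam K lam x y) = mulA (φ x) (φ y)) ∧
      (∀ S : {x : TypedTree D T // NoRootEdge t0 x},
        φ (Finsupp.single S.1 (1 : K)) = f S) := by
  classical
  let g : TypedTree D T → A := fun a => if ha : NoRootEdge t0 a then f ⟨a, ha⟩ else 0
  refine ⟨Finsupp.linearCombination K (TypedTree.freeExtension lam t0 mulA g), ⟨?_, ?_⟩, ?_⟩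
  · exact TypedTree.map_bulletLam_of_graftDefect fun d a m =>
      TypedTree.graftDefect_freeExtension h hA g _ d _ _ rfl _
        (TypedTree.single_mem_sizeSubmodule a 1) _
        (TypedTree.forestMonomial_mem_weightSubmodule t0 m)
  · rintro ⟨a, ha⟩
    rw [Finsupp.linearCombination_single, one_smul, TypedTree.freeExtension_of_forall_ne _ _ _
      ((TypedTree.noRootEdge_iff t0 a).1 ha)]
    exact dif_pos ha
  · rintro ψ ⟨hψ, hf⟩
    refine TypedTree.hom_ext_of_noRootEdge h hψ
      (TypedTree.map_bulletLam_of_graftDefect fun d a m =>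
        TypedTree.graftDefect_freeExtension h hA g _ d _ _ rfl _
          (TypedTree.single_mem_sizeSubmodule a 1) _
          (TypedTree.forestMonomial_mem_weightSubmodule t0 m)) fun a ha => ?_
    rw [hf ⟨a, ha⟩, Finsupp.linearCombination_single, one_smul,
      TypedTree.freeExtension_of_forall_ne _ _ _ ((TypedTree.noRootEdge_iff t0 a).1 ha)]
    simp only [g, dif_pos ha]
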